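/- arXiv:2403.12716 — 2 statements merged into one kernel-verified Lean document; each statement's English description precedes it below -/
import Mathlib

section
/- Let R be a commutative ring, n : ℕ, D : ℕ, and f, g : MvPolynomial (Fin n) R with degreeOf i f + degreeOf i g < D for every i : Fin n. Then for every exponent tuple k : Fin n → ℕ with k i < D for all i, the coefficient of the monomial ∏_i (X i)^(k i) in the product f * g equals the coefficient of x^(∑_i k i * D^(i : ℕ)) in the univariate product (φ_D f) * (φ_D g). -/
open MvPolynomial Polynomial

/-- Standard Kronecker substitution: sends `X i` to `x ^ (D ^ i)`. -/
noncomputable def kroneckerSubst (R : Type*) [CommRing R] (n D : ℕ) :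
    MvPolynomial (Fin n) R →ₐ[R] Polynomial R :=
  MvPolynomial.aeval (fun i : Fin n => (Polynomial.X : Polynomial R) ^ (D ^ (i : ℕ)))

theorem sum_mul_pow_injOn (n D : ℕ) {k l : Fin n → ℕ} (hk : ∀ i, k i < D) (hl : ∀ i, l i < D)
    (h : ∑ i : Fin n, k i * D ^ (i : ℕ) = ∑ i : Fin n, l i * D ^ (i : ℕ)) : k = l := by
  have key : (fun i => (⟨k i, hk i⟩ : Fin D)) = fun i => ⟨l i, hl i⟩ := by
    apply finFunctionFinEquiv.injective
    apply Fin.ext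
    simpa only [finFunctionFinEquiv_apply] using h
  funext i
  exact congrArg Fin.val (congrFun key i)

theorem kroneckerSubst_monomial {R : Type*} [CommRing R] (n D : ℕ) (m : Fin n →₀ ℕ) (r : R) :
    kroneckerSubst R n D (MvPolynomial.monomial m r) =
      Polynomial.monomial (∑ i : Fin n, m i * D ^ (i : ℕ)) r := by
  rw [kroneckerSubst, MvPolynomial.aeval_monomial, Finsupp.prod_fintype _ _ (by simp),
    ← Polynomial.C_mul_X_pow_eq_monomial, ← Finset.prod_pow_eq_pow_sum]
  simp only [← pow_mul, mul_comm]
  rfl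

theorem coeff_kroneckerSubst {R : Type*} [CommRing R] (n D : ℕ) (p : MvPolynomial (Fin n) R)
    (hp : ∀ i, p.degreeOf i < D) (k : Fin n →₀ ℕ) (hk : ∀ i, k i < D) :
    (kroneckerSubst R n D p).coeff (∑ i : Fin n, k i * D ^ (i : ℕ)) = p.coeff k := by
  conv_lhs => rw [p.as_sum, map_sum]
  simp only [kroneckerSubst_monomial, Polynomial.finsetSum_coeff, Polynomial.coeff_monomial]
  rw [Finset.sum_eq_single k]
  · simp
  · intro m hm hne
    refine if_neg fun h => hne (DFunLike.coe_injective ?_)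
    exact sum_mul_pow_injOn n D
      (fun i => (MvPolynomial.monomial_le_degreeOf i hm).trans_lt (hp i)) hk h
  · intro hk
    simpa using hk

theorem stmt_5 {R : Type*} [CommRing R] (n D : ℕ)
    (f g : MvPolynomial (Fin n) R)
    (hD : ∀ i : Fin n, f.degreeOf i + g.degreeOf i < D)
    (k : Fin n → ℕ) (hk : ∀ i : Fin n, k i < D) :
    MvPolynomial.coeff (Finsupp.equivFunOnFinite.symm k) (f * g) =
      (kroneckerSubst R n D f * kroneckerSubst R n D g).coeff
        (∑ i : Fin n, k i * D ^ (i : ℕ)) := by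
  rw [← map_mul]
  exact (coeff_kroneckerSubst n D (f * g)
    (fun i => (MvPolynomial.degreeOf_mul_le i f g).trans_lt (hD i))
    (Finsupp.equivFunOnFinite.symm k) hk).symm
end

section
/- Let R be a commutative ring, n ≥ 1 a natural number, and h : MvPolynomial (Fin n) R nonzero. Let H : ℕ → MvPolynomial (Fin n) R satisfy H 0 = h and, for every k with k + 1 < n, H (k+1) = ψ_{(k+1)→0, D_k} (H k) where D_k = degreeOf 0 (H k) + 1 (i.e., in the (k+1)-st step the variable X (k+1) is replaced by (X 0)^(degree of the current polynomial in X 0, plus 1)). Then ∏_{i : Fin n} degreeOf i h ≤ degreeOf 0 (H (n−1)) < ∏_{i : Fin n} (degreeOf i h + 1). -/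
open MvPolynomial

/-- Single Kronecker substitution: sends `X i` to `(X j) ^ D` and fixes every other variable. -/
noncomputable def singleKron (R : Type*) [CommRing R] {n : ℕ} (i j : Fin n) (D : ℕ) :
    MvPolynomial (Fin n) R →ₐ[R] MvPolynomial (Fin n) R :=
  MvPolynomial.aeval (fun m : Fin n =>
    if m = i then (MvPolynomial.X j : MvPolynomial (Fin n) R) ^ D else MvPolynomial.X m)

/-- The effect of the substitution `singleKron R i j D` on exponent vectors. -/
noncomputable def kronExponent {n : ℕ} (i j : Fin n) (D : ℕ) (s : Fin n →₀ ℕ) : Fin n →₀ ℕ :=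
  s.erase i + Finsupp.single j (D * s i)

section kronExponent

variable {n : ℕ} {i j : Fin n} (D : ℕ) (s : Fin n →₀ ℕ)

lemma kronExponent_apply_target (hij : i ≠ j) :
    kronExponent i j D s j = s j + D * s i := by
  simp [kronExponent, Finsupp.erase_ne hij.symm]

lemma kronExponent_apply_of_ne {m : Fin n} (hi : m ≠ i) (hj : m ≠ j) :
    kronExponent i j D s m = s m := by
  simp [kronExponent, Finsupp.erase_ne hi, Finsupp.single_eq_of_ne hj]

lemma kronExponent_injOn (hij : i ≠ j) :
    Set.InjOn (kronExponent i j D) {s | s j < D} := by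
  intro s hs t ht hst
  have hst' (m : Fin n) := DFunLike.congr_fun hst m
  have h_target := hst' j
  rw [kronExponent_apply_target D s hij, kronExponent_apply_target D t hij] at h_target
  have hj : s j = t j := by
    have := congrArg (· % D) h_target
    simpa [Nat.mod_eq_of_lt hs, Nat.mod_eq_of_lt ht] using this
  have hi : s i = t i := by
    rw [hj] at h_target
    exact Nat.eq_of_mul_eq_mul_left (Nat.zero_lt_of_lt hs) (Nat.add_left_cancel h_target)
  ext m
  by_cases hmi : m = i
  · rw [hmi, hi]
  by_cases hmj : m = j
  · rw [hmj, hj]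
  simpa [kronExponent_apply_of_ne D _ hmi hmj] using hst' m

end kronExponent

section singleKron

variable {R : Type*} [CommRing R] {n : ℕ} {i j : Fin n}

lemma singleKron_monomial (D : ℕ) (s : Fin n →₀ ℕ) (a : R) :
    singleKron R i j D (monomial s a) = monomial (kronExponent i j D s) a := by
  rw [singleKron, aeval_monomial, Finsupp.prod_fintype _ _ (fun _ => pow_zero _),
    ← Finset.mul_prod_erase _ _ (Finset.mem_univ i), kronExponent, monomial_eq (s := _ + _),
    Finsupp.prod_add_index' (fun _ => pow_zero _) (fun _ _ _ => pow_add _ _ _),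
    Finsupp.prod_single_index (h := fun m k => (X m : MvPolynomial (Fin n) R) ^ k) (pow_zero _),
    Finsupp.prod_fintype _ _ (fun _ => pow_zero _),
    ← Finset.mul_prod_erase _ (fun m => X m ^ (s.erase i) m) (Finset.mem_univ i)]
  have hprod : ∏ m ∈ Finset.univ.erase i,
        (if m = i then (X j : MvPolynomial (Fin n) R) ^ D else X m) ^ s m =
      ∏ m ∈ Finset.univ.erase i, X m ^ (s.erase i) m := by
    refine Finset.prod_congr rfl fun m hm => ?_
    have hmi := Finset.ne_of_mem_erase hm
    rw [if_neg hmi, Finsupp.erase_ne hmi]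
  rw [hprod, if_pos rfl, Finsupp.erase_same, pow_zero, one_mul, ← pow_mul, algebraMap_eq]
  ring

lemma support_singleKron (hij : i ≠ j) {D : ℕ} {p : MvPolynomial (Fin n) R}
    (hD : p.degreeOf j < D) :
    (singleKron R i j D p).support = p.support.image (kronExponent i j D) := by
  have hlt {s : Fin n →₀ ℕ} (hs : s ∈ p.support) : s j < D :=
    (monomial_le_degreeOf j hs).trans_lt hD
  have hsum : singleKron R i j D p =
      ∑ s ∈ p.support, monomial (kronExponent i j D s) (coeff s p) := by
    conv_lhs => rw [p.as_sum, map_sum]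
    simp only [singleKron_monomial]
  ext m
  rw [mem_support_iff, hsum, coeff_sum, Finset.mem_image]
  simp only [coeff_monomial]
  constructor
  · intro hne
    obtain ⟨s, hs, h⟩ := Finset.exists_ne_zero_of_sum_ne_zero hne
    exact ⟨s, hs, by_contra fun hsm => h (if_neg hsm)⟩
  · rintro ⟨s, hs, rfl⟩
    rw [Finset.sum_eq_single_of_mem s hs, if_pos rfl]
    · exact mem_support_iff.mp hs
    · intro t ht hts
      exact if_neg fun h => hts (kronExponent_injOn D hij (hlt ht) (hlt hs) h)

lemma degreeOf_singleKron (hij : i ≠ j) {D : ℕ} {p : MvPolynomial (Fin n) R}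
    (hD : p.degreeOf j < D) (m : Fin n) :
    (singleKron R i j D p).degreeOf m = p.support.sup fun s => kronExponent i j D s m := by
  rw [degreeOf_eq_sup, support_singleKron hij hD, Finset.sup_image]
  rfl

lemma degreeOf_singleKron_of_ne (hij : i ≠ j) {D : ℕ} {p : MvPolynomial (Fin n) R}
    (hD : p.degreeOf j < D) {m : Fin n} (hi : m ≠ i) (hj : m ≠ j) :
    (singleKron R i j D p).degreeOf m = p.degreeOf m := by
  simp only [degreeOf_singleKron hij hD, kronExponent_apply_of_ne D _ hi hj, degreeOf_eq_sup]

lemma mul_degreeOf_le_degreeOf_singleKron (hij : i ≠ j) {D : ℕ} {p : MvPolynomial (Fin n) R}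
    (hD : p.degreeOf j < D) :
    D * p.degreeOf i ≤ (singleKron R i j D p).degreeOf j := by
  rcases p.support.eq_empty_or_nonempty with hp | hp
  · simp [support_eq_empty.mp hp]
  obtain ⟨s, hs, hsi⟩ := Finset.exists_mem_eq_sup p.support hp fun s => s i
  rw [degreeOf_eq_sup i p, hsi, degreeOf_singleKron hij hD]
  refine le_trans ?_ (Finset.le_sup hs)
  rw [kronExponent_apply_target D s hij]
  exact Nat.le_add_left _ _

lemma degreeOf_singleKron_le (hij : i ≠ j) {D : ℕ} {p : MvPolynomial (Fin n) R}
    (hD : p.degreeOf j < D) :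
    (singleKron R i j D p).degreeOf j ≤ p.degreeOf j + D * p.degreeOf i := by
  rw [degreeOf_singleKron hij hD]
  refine Finset.sup_le fun s hs => ?_
  rw [kronExponent_apply_target D s hij]
  exact add_le_add (monomial_le_degreeOf j hs)
    (Nat.mul_le_mul_left D (monomial_le_degreeOf i hs))

end singleKron

theorem stmt_10 {R : Type*} [CommRing R] {n : ℕ} (hn : 1 ≤ n)
    (h : MvPolynomial (Fin n) R) (hh : h ≠ 0)
    (H : ℕ → MvPolynomial (Fin n) R) (H0 : H 0 = h)
    (Hstep : ∀ k, (hk : k + 1 < n) →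
      H (k + 1) =
        singleKron R (⟨k + 1, hk⟩ : Fin n) (⟨0, by omega⟩ : Fin n)
          ((H k).degreeOf ⟨0, by omega⟩ + 1) (H k)) :
    (∏ i : Fin n, h.degreeOf i) ≤ (H (n - 1)).degreeOf ⟨0, by omega⟩ ∧
      (H (n - 1)).degreeOf ⟨0, by omega⟩ < ∏ i : Fin n, (h.degreeOf i + 1) := by
  let d : ℕ → ℕ := fun m => if hm : m < n then h.degreeOf ⟨m, hm⟩ else 0
  have hd (m : Fin n) : h.degreeOf m = d m := by simp [d]
  have invariant (k : ℕ) (hk : k < n) :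
      (∀ m : Fin n, k < m → (H k).degreeOf m = d m) ∧
      ∏ m ∈ Finset.range (k + 1), d m ≤ (H k).degreeOf ⟨0, hn⟩ ∧
      (H k).degreeOf ⟨0, hn⟩ < ∏ m ∈ Finset.range (k + 1), (d m + 1) := by
    induction k with
    | zero => simp [H0, hd]
    | succ k ih =>
      obtain ⟨h_rest, h_lower, h_upper⟩ := ih (by omega)
      have hij : (⟨k + 1, hk⟩ : Fin n) ≠ ⟨0, hn⟩ := by simp
      have hD := Nat.lt_succ_self ((H k).degreeOf ⟨0, hn⟩)
      have h_var : (H k).degreeOf ⟨k + 1, hk⟩ = d (k + 1) := h_rest _ (Nat.lt_succ_self k)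
      rw [Hstep k hk, Finset.prod_range_succ, Finset.prod_range_succ _ (k + 1)]
      refine ⟨fun m hm => ?_, ?_, ?_⟩
      · rw [degreeOf_singleKron_of_ne hij hD (Fin.ne_of_gt hm)
          (Fin.ne_of_gt (Nat.zero_lt_of_lt hm))]
        exact h_rest m (Nat.lt_of_succ_lt hm)
      · refine le_trans ?_ (mul_degreeOf_le_degreeOf_singleKron hij hD)
        rw [h_var]
        exact Nat.mul_le_mul_right _ (h_lower.trans (Nat.le_succ _))
      · refine (degreeOf_singleKron_le hij hD).trans_lt ?_
        rw [h_var]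
        refine lt_of_lt_of_le ?_ (Nat.mul_le_mul_right _ h_upper)
        rw [Nat.mul_add, Nat.mul_one, add_comm]
        exact Nat.add_lt_add_left hD _
  obtain ⟨-, h_bounds⟩ := invariant (n - 1) (by omega)
  rw [Nat.sub_add_cancel hn, Finset.prod_range, Finset.prod_range] at h_bounds
  simpa only [hd] using h_bounds
end
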